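/- arXiv:2301.01066 — 4 statements merged into one kernel-verified Lean document; each statement's English description precedes it below -/
import Mathlib

section
/- Let m ≥ 5 be an odd integer. Then there exists a unique ω > 0 satisfying 2·sinh((m−1)·ω/4)·sinh((m+1)·ω/4) = sinh(ω/2)·sinh((m+1)·ω/2), and for every real s > 0 the Crank–Nicolson matrix satisfies ‖A_m(s)‖_∞ ≤ 1 if and only if s ≤ 1/(cosh(ω) − 1). -/
open Real Matrix Filter

noncomputable section

/-- Tridiagonal 0/1 matrix with ones on the sub- and super-diagonal. -/
def triMat (m : ℕ) : Matrix (Fin m) (Fin m) ℝ :=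
  fun i j => if (i : ℤ) - (j : ℤ) = 1 ∨ (j : ℤ) - (i : ℤ) = 1 then 1 else 0

/-- Crank–Nicolson iteration matrix `A_m(s)`. -/
def cnMat (m : ℕ) (s : ℝ) : Matrix (Fin m) (Fin m) ℝ :=
  ((1 + s) • (1 : Matrix (Fin m) (Fin m) ℝ) - (s / 2) • triMat m)⁻¹ *
    ((1 - s) • (1 : Matrix (Fin m) (Fin m) ℝ) + (s / 2) • triMat m)

/-- Maximum (row-sum) norm of a square matrix: max over rows of the sum of absolute values. -/
def maxNorm {m : ℕ} (A : Matrix (Fin m) (Fin m) ℝ) : ℝ :=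
  ⨆ i, ∑ j, |A i j|

/-- Chebyshev polynomials of the second kind. -/
def polyU : ℕ → Polynomial ℝ
  | 0 => 1
  | 1 => 2 * Polynomial.X
  | n + 2 => 2 * Polynomial.X * polyU (n + 1) - polyU n

/-- Polynomials `P_n`. -/
def polyP : ℕ → Polynomial ℝ
  | 0 => -1
  | 1 => 2 * Polynomial.X - 4
  | n + 2 => 2 * Polynomial.X * polyP (n + 1) - polyP n

/-- Polynomials `C_n`. -/
def polyC : ℕ → Polynomial ℝ
  | 0 => 0
  | 1 => 4 * (Polynomial.X - 1)
  | n + 2 => 2 * Polynomial.X * polyC (n + 1) - polyC n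

/-- The equation `coth(mω)·sinh(ω) = 3·cosh(ω) − 4`. -/
def cothEq (m : ℕ) (ω : ℝ) : Prop :=
  Real.cosh (m * ω) / Real.sinh (m * ω) * Real.sinh ω = 3 * Real.cosh ω - 4

/-- The contractivity equation for odd `m`. -/
def oddEq (m : ℕ) (ω : ℝ) : Prop :=
  2 * Real.sinh (((m : ℝ) - 1) * ω / 4) * Real.sinh (((m : ℝ) + 1) * ω / 4) =
    Real.sinh (ω / 2) * Real.sinh (((m : ℝ) + 1) * ω / 2)

/-- The contractivity equation for even `m`. -/
def evenEq (m : ℕ) (ω : ℝ) : Prop :=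
  Real.sinh (ω / 2) ^ 2 * Real.sinh ((m : ℝ) * ω / 2) *
      (Real.sinh (((m : ℝ) + 2) * ω / 2) - Real.sinh ((m : ℝ) * ω / 2)) =
    Real.sinh ω * Real.sinh (((m : ℝ) + 1) * ω / 2) * Real.sinh ((m : ℝ) * ω / 4) *
      Real.sinh (((m : ℝ) - 2) * ω / 4)

/-- For `0 < a < b` the quotient `sinh (b t) / sinh (a t)` is strictly increasing on `t > 0`. -/
theorem strictMonoOn_sinh_mul_div_sinh_mul {a b : ℝ} (ha : 0 < a) (hab : a < b) :
    StrictMonoOn (fun t : ℝ => sinh (b * t) / sinh (a * t)) (Set.Ioi 0) := by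
  have hb : 0 < b := ha.trans hab
  have dsinh (c t : ℝ) : HasDerivAt (fun t : ℝ => sinh (c * t)) (c * cosh (c * t)) t := by
    simpa [mul_comm] using ((hasDerivAt_id t).const_mul c).sinh
  have dcosh (c t : ℝ) : HasDerivAt (fun t : ℝ => cosh (c * t)) (c * sinh (c * t)) t := by
    simpa [mul_comm] using ((hasDerivAt_id t).const_mul c).cosh
  have hnum : StrictMonoOn
      (fun t : ℝ => b * cosh (b * t) * sinh (a * t) - sinh (b * t) * (a * cosh (a * t)))
      (Set.Ici 0) := by
    apply strictMonoOn_of_deriv_pos (convex_Ici 0) (by fun_prop)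
    intro t ht
    rw [interior_Ici, Set.mem_Ioi] at ht
    have hd := ((((dcosh b t).const_mul b).mul (dsinh a t)).sub
      ((dsinh b t).mul ((dcosh a t).const_mul a))).deriv
    refine lt_of_lt_of_eq ?_ hd.symm
    have h1 : 0 < sinh (a * t) := sinh_pos_iff.2 (by positivity)
    have h2 : 0 < sinh (b * t) := sinh_pos_iff.2 (by positivity)
    have h3 : 0 < (b - a) * (b + a) * (sinh (a * t) * sinh (b * t)) :=
      mul_pos (mul_pos (by linarith) (by linarith)) (mul_pos h1 h2)
    linarith
  have hne : ∀ t ∈ Set.Ioi (0 : ℝ), sinh (a * t) ≠ 0 := fun t ht =>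
    (sinh_pos_iff.2 (mul_pos ha ht)).ne'
  apply strictMonoOn_of_deriv_pos (convex_Ioi 0)
  · exact ContinuousOn.div (by fun_prop) (by fun_prop) hne
  intro t ht
  rw [interior_Ioi] at ht
  refine lt_of_lt_of_eq ?_ ((dsinh b t).div (dsinh a t) (hne t ht)).deriv.symm
  have h0 := hnum (Set.mem_Ici.2 le_rfl) (Set.mem_Ici.2 (le_of_lt ht)) ht
  simp only [mul_zero, sinh_zero, zero_mul, sub_zero] at h0
  exact div_pos h0 (pow_pos (sinh_pos_iff.2 (mul_pos ha ht)) 2)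

theorem three_mul_sinh_le_iff (p t : ℝ) :
    3 * sinh (p * t) ≤ sinh ((p + 2) * t) ↔
      sinh ((p + 1) * t) * cosh t ≤ 2 * sinh t * cosh ((p + 1) * t) := by
  have h1 : p * t = (p + 1) * t - t := by ring
  have h2 : (p + 2) * t = (p + 1) * t + t := by ring
  rw [h1, h2, sinh_sub, sinh_add]
  constructor <;> intro h <;> linarith

/-- The level `3` is attained by `sinh ((p + 2) t) / sinh (p t)`. -/
theorem exists_sinh_div_sinh_eq_three {p : ℝ} (hp : 2 ≤ p) :
    ∃ t : ℝ, 0 < t ∧ sinh ((p + 2) * t) / sinh (p * t) = 3 := by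
  have hcont : ContinuousOn (fun t : ℝ => sinh ((p + 2) * t) / sinh (p * t)) (Set.Ioi 0) :=
    ContinuousOn.div (by fun_prop) (by fun_prop) fun t ht =>
      (sinh_pos_iff.2 (mul_pos (by linarith) ht)).ne'
  have hsmall : ∃ t : ℝ, 0 < t ∧ sinh ((p + 2) * t) / sinh (p * t) ≤ 3 := by
    refine ⟨arsinh (1 / 3), arsinh_pos_iff.2 (by norm_num), ?_⟩
    set t : ℝ := arsinh (1 / 3)
    have ht0 : 0 < t := arsinh_pos_iff.2 (by norm_num)
    have hS : sinh t = 1 / 3 := sinh_arsinh _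
    have hC2 := cosh_sq t
    rw [div_le_iff₀ (sinh_pos_iff.2 (mul_pos (by linarith) ht0))]
    have hx : 0 ≤ sinh ((p - 2) * t) := sinh_nonneg_iff.2 (mul_nonneg (by linarith) ht0.le)
    have hy : 0 < cosh ((p - 2) * t) := cosh_pos _
    have e1 : p * t = (p - 2) * t + 2 * t := by ring
    have e2 : (p + 2) * t = (p - 2) * t + 2 * (2 * t) := by ring
    have h2 : cosh (2 * t) = 11 / 9 := by rw [cosh_two_mul, hC2, hS]; norm_num
    have h2' : 0 < sinh (2 * t) := sinh_pos_iff.2 (by linarith)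
    have h3 := sinh_sq (2 * t)
    rw [e1, e2, sinh_add, sinh_add, sinh_two_mul (2 * t), cosh_two_mul (2 * t), h3, h2]
    nlinarith [mul_pos hy h2']
  have hlarge : ∃ t : ℝ, 0 < t ∧ 3 ≤ sinh ((p + 2) * t) / sinh (p * t) := by
    refine ⟨log 2, log_pos (by norm_num), ?_⟩
    have ht0 : 0 < log 2 := log_pos (by norm_num)
    rw [le_div_iff₀ (sinh_pos_iff.2 (mul_pos (by linarith) ht0)), three_mul_sinh_le_iff]
    have hS : sinh (log 2) = 3 / 4 := by rw [sinh_log (by norm_num)]; norm_num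
    have hC : cosh (log 2) = 5 / 4 := by rw [cosh_log (by norm_num)]; norm_num
    rw [hS, hC]
    have := sinh_lt_cosh ((p + 1) * log 2)
    have := cosh_pos ((p + 1) * log 2)
    linarith
  obtain ⟨t₁, h1, h1'⟩ := hsmall
  obtain ⟨t₂, h2, h2'⟩ := hlarge
  obtain ⟨t, ht, he⟩ := isPreconnected_Ioi.intermediate_value (Set.mem_Ioi.2 h1)
    (Set.mem_Ioi.2 h2) hcont ⟨h1', h2'⟩
  exact ⟨t, ht, he⟩

theorem oddEq_two_mul_iff {p : ℕ} (hp : 0 < p) {t : ℝ} (ht : 0 < t) :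
    oddEq (2 * p + 1) (2 * t) ↔ sinh (((p : ℝ) + 2) * t) / sinh (p * t) = 3 := by
  have hp' : (0 : ℝ) < p := by exact_mod_cast hp
  have e1 : (((2 * p + 1 : ℕ) : ℝ) - 1) * (2 * t) / 4 = (p + 1) * t - t := by push_cast; ring
  have e2 : (((2 * p + 1 : ℕ) : ℝ) + 1) * (2 * t) / 4 = (p + 1) * t := by push_cast; ring
  have e3 : (((2 * p + 1 : ℕ) : ℝ) + 1) * (2 * t) / 2 = 2 * ((p + 1) * t) := by push_cast; ring
  have e4 : 2 * t / 2 = t := by ring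
  have e5 : (p : ℝ) * t = (p + 1) * t - t := by ring
  have e6 : ((p : ℝ) + 2) * t = (p + 1) * t + t := by ring
  have hpos : 0 < sinh ((p : ℝ) * t) := sinh_pos_iff.2 (by positivity)
  have hq : 0 < sinh (((p : ℝ) + 1) * t) := sinh_pos_iff.2 (by positivity)
  rw [div_eq_iff hpos.ne', oddEq, e1, e2, e3, e4, e5, e6, sinh_two_mul, sinh_sub, sinh_add]
  constructor
  · intro h
    have h' : 2 * (sinh (((p : ℝ) + 1) * t) * cosh t - cosh (((p : ℝ) + 1) * t) * sinh t) =
        2 * sinh t * cosh (((p : ℝ) + 1) * t) :=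
      mul_right_cancel₀ hq.ne' (by linarith)
    linarith
  · intro h
    linear_combination (-sinh (((p : ℝ) + 1) * t)) * h

/-- The action of `triMat` on the restriction of a sequence vanishing just outside the index
range. -/
theorem triMat_sum_mul {m : ℕ} (f : ℕ → ℝ) (h0 : f 0 = 0) (hm : f (m + 1) = 0) (i : Fin m) :
    ∑ k, triMat m i k * f (k + 1) = f i + f (i + 2) := by
  have hsplit : ∀ k : Fin m, triMat m i k * f (k + 1) =
      (if (k : ℕ) + 1 = i then f i else 0) + (if (k : ℕ) = i + 1 then f (i + 2) else 0) := by
    intro k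
    unfold triMat
    by_cases h1 : (k : ℕ) + 1 = i
    · have h2 : ¬ (k : ℕ) = i + 1 := by omega
      have h3 : (i : ℤ) - (k : ℤ) = 1 := by omega
      simp [h2, h3, h1]
    · by_cases h2 : (k : ℕ) = i + 1
      · have h3 : (k : ℤ) - (i : ℤ) = 1 := by omega
        rw [if_pos (Or.inr h3), if_neg h1, if_pos h2, h2, one_mul, zero_add]
      · have h3 : ¬ ((i : ℤ) - (k : ℤ) = 1 ∨ (k : ℤ) - (i : ℤ) = 1) := by omega
        simp [h1, h2, h3]
  have hi := i.isLt
  rw [Finset.sum_congr rfl fun k _ => hsplit k, Finset.sum_add_distrib,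
    Fin.sum_univ_eq_sum_range (fun k => if k + 1 = (i : ℕ) then f i else 0),
    Fin.sum_univ_eq_sum_range (fun k => if k = (i : ℕ) + 1 then f (i + 2) else 0)]
  congr 1
  · rcases Nat.eq_zero_or_pos (i : ℕ) with h | h
    · simp [h, h0]
    · rw [Finset.sum_eq_single ((i : ℕ) - 1)]
      · rw [if_pos (by omega)]
      · intro k _ hk
        rw [if_neg (by omega)]
      · intro hk
        exact absurd (Finset.mem_range.2 (by omega)) hk
  · rw [Finset.sum_ite_eq']
    split_ifs with h
    · rfl
    · rw [Finset.mem_range] at h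
      rw [show (i : ℕ) + 2 = m + 1 by omega, hm]

/-- The implicit matrix of the Crank–Nicolson step. -/
def implicitMat (m : ℕ) (s : ℝ) : Matrix (Fin m) (Fin m) ℝ :=
  (1 + s) • (1 : Matrix (Fin m) (Fin m) ℝ) - (s / 2) • triMat m

theorem implicitMat_sum_mul {m : ℕ} (s : ℝ) (f : ℕ → ℝ) (h0 : f 0 = 0) (hm : f (m + 1) = 0)
    (i : Fin m) :
    ∑ k, implicitMat m s i k * f (k + 1) = (1 + s) * f (i + 1) - s / 2 * (f i + f (i + 2)) := by
  rw [← triMat_sum_mul f h0 hm i]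
  simp [implicitMat, sub_mul, Finset.sum_sub_distrib, Matrix.one_apply, Finset.mul_sum, mul_assoc]

/-- The discrete Green's function, for indices counted from `1`. -/
def greenFun (m : ℕ) (t : ℝ) (k l : ℕ) : ℝ :=
  2 * (cosh (2 * t) - 1) / (sinh (2 * t) * sinh (((m : ℝ) + 1) * (2 * t))) *
    (sinh ((min k l : ℕ) * (2 * t)) * sinh (((m : ℝ) + 1 - (max k l : ℕ)) * (2 * t)))

theorem greenFun_pos {m : ℕ} {t : ℝ} (ht : 0 < t) {k l : ℕ} (hk : 0 < k) (hl : 0 < l)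
    (hk' : k ≤ m) (hl' : l ≤ m) : 0 < greenFun m t k l := by
  have h1 : (0 : ℝ) < (min k l : ℕ) := by exact_mod_cast lt_min hk hl
  have h2 : ((max k l : ℕ) : ℝ) ≤ m := by exact_mod_cast max_le hk' hl'
  have h3 : 0 < (m : ℝ) + 1 - (max k l : ℕ) := by linarith
  have h4 : 0 < cosh (2 * t) - 1 := sub_pos.2 (one_lt_cosh.2 (by positivity))
  have h5 : 0 < sinh (2 * t) := sinh_pos_iff.2 (by positivity)
  have h6 : 0 < sinh (((m : ℝ) + 1) * (2 * t)) := sinh_pos_iff.2 (by positivity)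
  have h7 : 0 < sinh ((min k l : ℕ) * (2 * t)) := sinh_pos_iff.2 (by positivity)
  have h8 : 0 < sinh (((m : ℝ) + 1 - (max k l : ℕ)) * (2 * t)) := sinh_pos_iff.2 (by positivity)
  unfold greenFun
  positivity

theorem implicitMat_mul_green {m : ℕ} {s t : ℝ} (ht : 0 < t) (hs : s * (cosh (2 * t) - 1) = 1) :
    implicitMat m s * Matrix.of (fun k l : Fin m => greenFun m t (k + 1) (l + 1)) = 1 := by
  have h5 : 0 < sinh (2 * t) := sinh_pos_iff.2 (by positivity)
  have h6 : 0 < sinh (((m : ℝ) + 1) * (2 * t)) := sinh_pos_iff.2 (by positivity)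
  ext i j
  have hi := i.isLt
  have hj := j.isLt
  rw [Matrix.mul_apply, Matrix.one_apply]
  simp only [Matrix.of_apply]
  rw [implicitMat_sum_mul s (fun k => greenFun m t k (j + 1)) (by simp [greenFun])
    (by simp [greenFun])]
  have hc : 1 + s = s * cosh (2 * t) := by linarith
  simp only [greenFun]
  set c := 2 * (cosh (2 * t) - 1) / (sinh (2 * t) * sinh (((m : ℝ) + 1) * (2 * t))) with hcdef
  rcases lt_trichotomy (i : ℕ) j with h | h | h
  · rw [if_neg (fun e => by simp [e] at h),
      min_eq_left (by omega : (i : ℕ) + 1 ≤ j + 1), min_eq_left (by omega : (i : ℕ) ≤ j + 1),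
      min_eq_left (by omega : (i : ℕ) + 2 ≤ j + 1), max_eq_right (by omega : (i : ℕ) + 1 ≤ j + 1),
      max_eq_right (by omega : (i : ℕ) ≤ j + 1), max_eq_right (by omega : (i : ℕ) + 2 ≤ j + 1)]
    have e1 : ((i : ℕ) : ℝ) * (2 * t) = ((i + 1 : ℕ) : ℝ) * (2 * t) - 2 * t := by push_cast; ring
    have e2 : ((i + 2 : ℕ) : ℝ) * (2 * t) = ((i + 1 : ℕ) : ℝ) * (2 * t) + 2 * t := by
      push_cast; ring
    rw [e1, e2, sinh_sub, sinh_add, hc]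
    ring
  · have hij : i = j := Fin.ext h
    subst hij
    rw [if_pos rfl, min_self, max_self, min_eq_left (by omega : (i : ℕ) ≤ i + 1),
      min_eq_right (by omega : (i : ℕ) + 1 ≤ i + 2), max_eq_right (by omega : (i : ℕ) ≤ i + 1),
      max_eq_left (by omega : (i : ℕ) + 1 ≤ i + 2)]
    have e1 : ((i : ℕ) : ℝ) * (2 * t) = ((i + 1 : ℕ) : ℝ) * (2 * t) - 2 * t := by push_cast; ring
    have e2 : ((m : ℝ) + 1 - (i + 2 : ℕ)) * (2 * t) =
        ((m : ℝ) + 1 - (i + 1 : ℕ)) * (2 * t) - 2 * t := by push_cast; ring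
    have e3 : ((m : ℝ) + 1) * (2 * t) =
        ((i + 1 : ℕ) : ℝ) * (2 * t) + ((m : ℝ) + 1 - (i + 1 : ℕ)) * (2 * t) := by ring
    have hcs : s / 2 * c * (sinh (2 * t) * sinh (((m : ℝ) + 1) * (2 * t))) = 1 := by
      rw [hcdef]
      field_simp
      linarith
    rw [e3, sinh_add] at hcs
    rw [e1, e2, sinh_sub, sinh_sub, hc]
    linear_combination hcs
  · rw [if_neg (fun e => by simp [e] at h),
      min_eq_right (by omega : (j : ℕ) + 1 ≤ i + 1), min_eq_right (by omega : (j : ℕ) + 1 ≤ i),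
      min_eq_right (by omega : (j : ℕ) + 1 ≤ i + 2), max_eq_left (by omega : (j : ℕ) + 1 ≤ i + 1),
      max_eq_left (by omega : (j : ℕ) + 1 ≤ i), max_eq_left (by omega : (j : ℕ) + 1 ≤ i + 2)]
    have e1 : ((m : ℝ) + 1 - (i : ℕ)) * (2 * t) =
        ((m : ℝ) + 1 - (i + 1 : ℕ)) * (2 * t) + 2 * t := by push_cast; ring
    have e2 : ((m : ℝ) + 1 - (i + 2 : ℕ)) * (2 * t) =
        ((m : ℝ) + 1 - (i + 1 : ℕ)) * (2 * t) - 2 * t := by push_cast; ring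
    rw [e1, e2, sinh_sub, sinh_add, hc]
    ring

theorem sum_greenFun {m : ℕ} {s t : ℝ} (ht : 0 < t) (hs : s * (cosh (2 * t) - 1) = 1)
    (i : Fin m) :
    ∑ j : Fin m, greenFun m t (i + 1) (j + 1) =
      1 - cosh ((2 * (i + 1 : ℕ) - ((m : ℝ) + 1)) * t) / cosh (((m : ℝ) + 1) * t) := by
  set f : ℕ → ℝ := fun k =>
    1 - cosh ((2 * (k : ℕ) - ((m : ℝ) + 1)) * t) / cosh (((m : ℝ) + 1) * t) with hf
  have hpos := cosh_pos (((m : ℝ) + 1) * t)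
  have h0 : f 0 = 0 := by
    simp only [hf]
    rw [show (2 * ((0 : ℕ) : ℝ) - ((m : ℝ) + 1)) * t = -(((m : ℝ) + 1) * t) by push_cast; ring,
      cosh_neg, div_self hpos.ne', sub_self]
  have hm : f (m + 1) = 0 := by
    simp only [hf]
    rw [show (2 * ((m + 1 : ℕ) : ℝ) - ((m : ℝ) + 1)) * t = ((m : ℝ) + 1) * t by push_cast; ring,
      div_self hpos.ne', sub_self]
  have hM : implicitMat m s *ᵥ (fun k : Fin m => f (k + 1)) = fun _ => 1 := by
    ext k
    have h := implicitMat_sum_mul s f h0 hm k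
    rw [Matrix.mulVec, dotProduct, h]
    simp only [hf]
    have e1 : (2 * ((k : ℕ) : ℝ) - ((m : ℝ) + 1)) * t =
        (2 * ((k + 1 : ℕ) : ℝ) - ((m : ℝ) + 1)) * t - 2 * t := by push_cast; ring
    have e2 : (2 * ((k + 2 : ℕ) : ℝ) - ((m : ℝ) + 1)) * t =
        (2 * ((k + 1 : ℕ) : ℝ) - ((m : ℝ) + 1)) * t + 2 * t := by push_cast; ring
    have hc : 1 + s = s * cosh (2 * t) := by linarith
    rw [e1, e2, cosh_sub, cosh_add]
    linear_combination
      (-cosh ((2 * ((k + 1 : ℕ) : ℝ) - ((m : ℝ) + 1)) * t) / cosh (((m : ℝ) + 1) * t)) * hc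
  have hG := mul_eq_one_comm.1 (implicitMat_mul_green (m := m) ht hs)
  have := congrFun (congrArg (Matrix.mulVec (Matrix.of
    (fun k l : Fin m => greenFun m t (k + 1) (l + 1)))) hM) i
  rw [Matrix.mulVec_mulVec, hG, Matrix.one_mulVec] at this
  exact (by simp [Matrix.mulVec, dotProduct] : _ = _).trans this.symm

theorem cnMat_eq {m : ℕ} {s t : ℝ} (ht : 0 < t) (hs : s * (cosh (2 * t) - 1) = 1) :
    cnMat m s = (2 : ℝ) • Matrix.of (fun k l : Fin m => greenFun m t (k + 1) (l + 1)) - 1 := by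
  have h := implicitMat_mul_green (m := m) ht hs
  have e : (1 - s) • (1 : Matrix (Fin m) (Fin m) ℝ) + (s / 2) • triMat m =
      (2 : ℝ) • 1 - implicitMat m s := by
    unfold implicitMat
    module
  rw [cnMat, e, ← implicitMat, Matrix.inv_eq_right_inv h, mul_sub, mul_smul_comm, mul_one,
    mul_eq_one_comm.1 h]

/-- For nonnegative `G` with row sums at most `1`, the absolute row sum of `2 G - 1` is at most `1`
exactly when the diagonal entry of `G` carries at least half of its row. -/
theorem sum_abs_two_mul_sub_one_le_one_iff {m : ℕ} (g : Fin m → ℝ) (hg : ∀ j, 0 ≤ g j)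
    (hsum : ∑ j, g j ≤ 1) (i : Fin m) :
    ∑ j, |2 * g j - (1 : Matrix (Fin m) (Fin m) ℝ) i j| ≤ 1 ↔ ∑ j, g j ≤ 2 * g i := by
  have h1 : ∑ j, |2 * g j - (1 : Matrix (Fin m) (Fin m) ℝ) i j| =
      |2 * g i - 1| + (2 * ∑ j, g j - 2 * g i) := by
    rw [← Finset.add_sum_erase _ _ (Finset.mem_univ i),
      ← Finset.add_sum_erase _ g (Finset.mem_univ i), Matrix.one_apply_eq]
    congr 1
    rw [Finset.sum_congr rfl (g := fun j => 2 * g j), ← Finset.mul_sum]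
    · ring
    · intro j hj
      rw [Matrix.one_apply_ne (Finset.ne_of_mem_erase hj).symm, sub_zero,
        abs_of_nonneg (by linarith [hg j])]
  rw [h1]
  rcases abs_cases (2 * g i - 1) with ⟨h, h'⟩ | ⟨h, h'⟩ <;> rw [h] <;> constructor <;> intro h2 <;>
    linarith

theorem maxNorm_le_one_iff {m : ℕ} (hm : 0 < m) (A : Matrix (Fin m) (Fin m) ℝ) :
    maxNorm A ≤ 1 ↔ ∀ i, ∑ j, |A i j| ≤ 1 := by
  have : Nonempty (Fin m) := ⟨⟨0, hm⟩⟩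
  exact ciSup_le_iff (Set.finite_range _).bddAbove

theorem one_sub_cosh_div_cosh_le_iff {a b t : ℝ} (ha : 0 < a) (hb : 0 < b) (ht : 0 < t) :
    1 - cosh (a - b) / cosh (a + b) ≤ 2 * (2 * (cosh (2 * t) - 1) /
        (sinh (2 * t) * sinh (2 * (a + b))) * (sinh (2 * a) * sinh (2 * b))) ↔
      sinh (a + b) * cosh t ≤ 2 * sinh t * (cosh (a + b) + cosh (a - b)) := by
  have hsa : 0 < sinh a := sinh_pos_iff.2 ha
  have hsb : 0 < sinh b := sinh_pos_iff.2 hb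
  have hst : 0 < sinh t := sinh_pos_iff.2 ht
  have hs : 0 < sinh (a + b) := sinh_pos_iff.2 (by positivity)
  have hc : 0 < cosh (a + b) := cosh_pos _
  have hct : 0 < cosh t := cosh_pos t
  set r := 2 * sinh a * sinh b / cosh (a + b) with hr
  have hr0 : 0 < r := by positivity
  have h1 : 1 - cosh (a - b) / cosh (a + b) = r := by
    rw [hr, one_sub_div hc.ne', cosh_sub, cosh_add]
    congr 1
    ring
  have h2 : 2 * (2 * (cosh (2 * t) - 1) / (sinh (2 * t) * sinh (2 * (a + b))) *
      (sinh (2 * a) * sinh (2 * b))) =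
      r * (2 * sinh t * (cosh (a + b) + cosh (a - b)) / (sinh (a + b) * cosh t)) := by
    have e1 : cosh (2 * t) - 1 = 2 * sinh t ^ 2 := by rw [cosh_two_mul, cosh_sq]; ring
    have e2 : cosh (a + b) + cosh (a - b) = 2 * (cosh a * cosh b) := by
      rw [cosh_add, cosh_sub]; ring
    rw [e1, e2, hr, sinh_two_mul t, sinh_two_mul a, sinh_two_mul b, sinh_two_mul (a + b)]
    field_simp
  rw [h1, h2, le_mul_iff_one_le_right hr0, one_le_div (by positivity)]

theorem maxNorm_cnMat_le_one_iff {p : ℕ} (hp : 0 < p) {s t : ℝ} (ht : 0 < t)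
    (hs : s * (cosh (2 * t) - 1) = 1) :
    maxNorm (cnMat (2 * p + 1) s) ≤ 1 ↔ 3 ≤ sinh (((p : ℝ) + 2) * t) / sinh (p * t) := by
  have hp' : (0 : ℝ) < p := by exact_mod_cast hp
  have hq : 0 < cosh (((p : ℝ) + 1) * t) := cosh_pos _
  have hrow (i : Fin (2 * p + 1)) : ∑ j, |cnMat (2 * p + 1) s i j| ≤ 1 ↔
      sinh (2 * ((p + 1) * t)) * cosh t ≤ 2 * sinh t *
        (cosh (2 * ((p + 1) * t)) + cosh (2 * (((i : ℕ) : ℝ) - p) * t)) := by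
    have hi := i.isLt
    have hi' : ((i : ℕ) : ℝ) < 2 * p + 1 := by exact_mod_cast hi
    have hsum := sum_greenFun ht hs i
    rw [cnMat_eq ht hs]
    simp only [Matrix.sub_apply, Matrix.smul_apply, Matrix.of_apply, smul_eq_mul]
    rw [sum_abs_two_mul_sub_one_le_one_iff
      (fun j : Fin (2 * p + 1) => greenFun (2 * p + 1) t (i + 1) (j + 1))
      (fun j => (greenFun_pos ht (by omega) (by omega) (by omega) (by omega)).le)
      (by rw [hsum]; exact sub_le_self _ (div_nonneg (cosh_pos _).le (cosh_pos _).le)), hsum]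
    have ea : ((2 * p + 1 : ℕ) : ℝ) + 1 = 2 * (p + 1) := by push_cast; ring
    have e1 : ((i : ℕ) + 1 : ℝ) * t + (2 * p + 1 - (i : ℕ)) * t = 2 * (p + 1) * t := by ring
    have e2 : ((i : ℕ) + 1 : ℝ) * t - (2 * p + 1 - (i : ℕ)) * t = 2 * ((i : ℕ) - p) * t := by ring
    have key := one_sub_cosh_div_cosh_le_iff (a := ((i : ℕ) + 1 : ℝ) * t)
      (b := (2 * p + 1 - (i : ℕ) : ℝ) * t) (by positivity)
      (mul_pos (by linarith) ht) ht
    rw [e1, e2] at key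
    rw [greenFun, min_self, max_self, ea, ← mul_assoc 2 ((p : ℝ) + 1) t, ← key]
    have e3 : (2 * ((i + 1 : ℕ) : ℝ) - 2 * (p + 1)) * t = 2 * ((i : ℕ) - p) * t := by
      push_cast; ring
    have e4 : ((i + 1 : ℕ) : ℝ) * (2 * t) = 2 * (((i : ℕ) + 1) * t) := by push_cast; ring
    have e5 : (2 * (p + 1) - ((i + 1 : ℕ) : ℝ)) * (2 * t) =
        2 * ((2 * p + 1 - (i : ℕ)) * t) := by push_cast; ring
    have e6 : 2 * ((p : ℝ) + 1) * (2 * t) = 2 * (2 * (p + 1) * t) := by ring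
    rw [e3, e4, e5, e6]
  have hmid : 3 ≤ sinh (((p : ℝ) + 2) * t) / sinh (p * t) ↔
      sinh (2 * ((p + 1) * t)) * cosh t ≤ 2 * sinh t * (cosh (2 * ((p + 1) * t)) + 1) := by
    rw [le_div_iff₀ (sinh_pos_iff.2 (by positivity)), three_mul_sinh_le_iff, sinh_two_mul,
      cosh_two_mul, sinh_sq]
    constructor
    · intro h
      linarith [mul_le_mul_of_nonneg_left h hq.le]
    · intro h
      exact le_of_mul_le_mul_left (by linarith) hq
  rw [maxNorm_le_one_iff (by omega), hmid]
  constructor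
  · intro h
    simpa using (hrow ⟨p, by omega⟩).1 (h ⟨p, by omega⟩)
  · intro h i
    refine (hrow i).2 (h.trans ?_)
    have := one_le_cosh (2 * (((i : ℕ) : ℝ) - p) * t)
    have : 0 < sinh t := sinh_pos_iff.2 ht
    gcongr

theorem stmt5 (m : ℕ) (hm : 5 ≤ m) (hodd : Odd m) :
    ∃ ω : ℝ, 0 < ω ∧ oddEq m ω ∧
      (∀ ω' : ℝ, 0 < ω' → oddEq m ω' → ω' = ω) ∧
      ∀ s : ℝ, 0 < s →
        (maxNorm (cnMat m s) ≤ 1 ↔ s ≤ 1 / (Real.cosh ω - 1)) := by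
  obtain ⟨p, rfl⟩ := hodd
  have hp : 2 ≤ p := by omega
  have hp' : (2 : ℝ) ≤ p := by exact_mod_cast hp
  have hmono := strictMonoOn_sinh_mul_div_sinh_mul (a := p) (b := p + 2)
    (by linarith) (by linarith)
  obtain ⟨t₀, ht₀, h3⟩ := exists_sinh_div_sinh_eq_three hp'
  refine ⟨2 * t₀, by positivity, (oddEq_two_mul_iff (by omega) ht₀).2 h3, ?_, ?_⟩
  · intro ω hω h
    have hω' : 0 < ω / 2 := by positivity
    rw [show ω = 2 * (ω / 2) by ring, oddEq_two_mul_iff (by omega) hω'] at h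
    have := hmono.injOn (Set.mem_Ioi.2 hω') (Set.mem_Ioi.2 ht₀) (h.trans h3.symm)
    linarith
  · intro s hs
    set t := arsinh (√(1 / (2 * s))) with htdef
    have ht : 0 < t := arsinh_pos_iff.2 (sqrt_pos.2 (by positivity))
    have hcosh : cosh (2 * t) - 1 = 1 / s := by
      rw [cosh_two_mul, cosh_sq, htdef, sinh_arsinh, sq_sqrt (by positivity)]
      field_simp
      ring
    have hpos : 0 < cosh (2 * t₀) - 1 := sub_pos.2 (one_lt_cosh.2 (by positivity))
    rw [maxNorm_cnMat_le_one_iff (by omega) ht (by rw [hcosh]; field_simp), ← h3,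
      hmono.le_iff_le (Set.mem_Ioi.2 ht₀) (Set.mem_Ioi.2 ht), le_one_div hs hpos, ← hcosh,
      sub_le_sub_iff_right, cosh_le_cosh, abs_of_pos (by positivity), abs_of_pos (by positivity)]
    constructor <;> intro h <;> linarith
end
end

section
/- For every integer m ≥ 1 and every real s > 0, if all entries of the Crank–Nicolson matrix A_m(s) are nonnegative, then ‖A_m(s)‖_∞ ≤ 1. -/
open Real Matrix Filter

noncomputable section

theorem triMat_nonneg {m : ℕ} (i j : Fin m) : 0 ≤ triMat m i j := by
  unfold triMat
  split_ifs <;> norm_num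

theorem triMat_diag {m : ℕ} (i : Fin m) : triMat m i i = 0 := by
  simp [triMat]

theorem sum_triMat_le_two {m : ℕ} (i : Fin m) : ∑ j, triMat m i j ≤ 2 := by
  have hcard : (Finset.univ.filter
      fun j : Fin m => (i : ℤ) - (j : ℤ) = 1 ∨ (j : ℤ) - (i : ℤ) = 1).card ≤ 2 := by
    rw [Finset.filter_or]
    refine (Finset.card_union_le _ _).trans (Nat.add_le_add (b := 1) (d := 1) ?_ ?_) <;>
    · refine Finset.card_le_one.2 fun a ha b hb => Fin.ext ?_
      simp only [Finset.mem_filter, Finset.mem_univ, true_and] at ha hb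
      omega
  simp only [triMat, Finset.sum_boole]
  exact_mod_cast hcard

theorem isUnit_det_implicitMat (m : ℕ) {s : ℝ} (hs : 0 < s) :
    IsUnit (implicitMat m s).det := by
  refine (det_ne_zero_of_sum_row_lt_diag fun i => ?_).isUnit
  have hdiag : ‖implicitMat m s i i‖ = 1 + s := by
    simp only [implicitMat, Matrix.sub_apply, Matrix.smul_apply, one_apply_eq, triMat_diag,
      smul_eq_mul, mul_one, mul_zero, sub_zero, Real.norm_eq_abs]
    exact abs_of_pos (by linarith)
  have hoff : ∀ j ∈ Finset.univ.erase i, ‖implicitMat m s i j‖ = s / 2 * triMat m i j := by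
    intro j hj
    simp only [implicitMat, Matrix.sub_apply, Matrix.smul_apply,
      one_apply_ne (Finset.ne_of_mem_erase hj).symm,
      smul_eq_mul, mul_zero, zero_sub, norm_neg, Real.norm_eq_abs]
    exact abs_of_nonneg (mul_nonneg (by linarith) (triMat_nonneg i j))
  rw [hdiag, Finset.sum_congr rfl hoff, ← Finset.mul_sum,
    Finset.sum_erase _ (triMat_diag i)]
  nlinarith [sum_triMat_le_two i]

theorem one_le_implicitMat_mulVec_one (m : ℕ) {s : ℝ} (hs : 0 < s) (i : Fin m) :
    1 ≤ (implicitMat m s *ᵥ 1) i := by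
  have h : (implicitMat m s *ᵥ 1) i = (1 + s) - s / 2 * ∑ j, triMat m i j := by
    simp [implicitMat, mulVec, dotProduct, Finset.mul_sum, one_apply]
  rw [h]
  nlinarith [sum_triMat_le_two i]

theorem cnMat_eq_s9 (m : ℕ) {s : ℝ} (hs : 0 < s) :
    cnMat m s = (2 : ℝ) • (implicitMat m s)⁻¹ - 1 := by
  have h : (1 - s) • (1 : Matrix (Fin m) (Fin m) ℝ) + (s / 2) • triMat m =
      (2 : ℝ) • 1 - implicitMat m s := by
    unfold implicitMat
    module
  rw [cnMat, h, ← implicitMat, mul_sub, nonsing_inv_mul _ (isUnit_det_implicitMat m hs),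
    mul_smul_comm, mul_one]

theorem stmt9 (m : ℕ) (hm : 1 ≤ m) (s : ℝ) (hs : 0 < s)
    (hpos : ∀ i j, 0 ≤ cnMat m s i j) :
    maxNorm (cnMat m s) ≤ 1 := by
  have hinv (i j : Fin m) : 0 ≤ (implicitMat m s)⁻¹ i j := by
    have h := hpos i j
    rw [cnMat_eq_s9 m hs] at h
    simp only [Matrix.sub_apply, Matrix.smul_apply, smul_eq_mul] at h
    have : (0 : ℝ) ≤ (1 : Matrix (Fin m) (Fin m) ℝ) i j := by
      rw [one_apply]
      split_ifs <;> norm_num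
    linarith
  have : Nonempty (Fin m) := ⟨⟨0, hm⟩⟩
  refine ciSup_le fun i => ?_
  simp only [abs_of_nonneg (hpos _ _)]
  have hle : ∑ j, (implicitMat m s)⁻¹ i j ≤ 1 := calc
    ∑ j, (implicitMat m s)⁻¹ i j
        ≤ ∑ j, (implicitMat m s)⁻¹ i j * (implicitMat m s *ᵥ 1) j :=
      Finset.sum_le_sum fun j _ =>
        le_mul_of_one_le_right (hinv i j) (one_le_implicitMat_mulVec_one m hs j)
    _ = ((implicitMat m s)⁻¹ *ᵥ (implicitMat m s *ᵥ 1)) i := rfl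
    _ = 1 := by
      rw [mulVec_mulVec, nonsing_inv_mul _ (isUnit_det_implicitMat m hs), one_mulVec,
        Pi.one_apply]
  have hsum : ∑ j, cnMat m s i j = 2 * ∑ j, (implicitMat m s)⁻¹ i j - 1 := by
    simp [cnMat_eq_s9 m hs, Finset.mul_sum, one_apply]
  linarith
end
end

section
/- For every integer m ≥ 1, there exists exactly one real x > 1 with P_m(x) = 0, and this root satisfies (6 + √2)/4 < x ≤ 2. -/
open Real Matrix Filter

noncomputable section

/-- The continued fraction `U_{n-1}/U_n`. -/
def chebRatio : ℕ → ℝ → ℝ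
  | 0, _ => 0
  | n + 1, x => (2 * x - chebRatio n x)⁻¹

lemma chebRatio_mem_Icc (n : ℕ) {x : ℝ} (hx : 1 ≤ x) :
    0 ≤ chebRatio n x ∧ chebRatio n x ≤ 1 := by
  induction n with
  | zero => simp [chebRatio]
  | succ n ih =>
    have h : 1 ≤ 2 * x - chebRatio n x := by linarith [ih.2]
    exact ⟨inv_nonneg.2 (by linarith), inv_le_one_of_one_le₀ h⟩

lemma chebRatio_convexOn (n : ℕ) : ConvexOn ℝ (Set.Ici 1) (chebRatio n) := by
  refine ⟨convex_Ici 1, ?_⟩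
  intro x hx y hy a b ha hb hab
  have hx' : (1 : ℝ) ≤ x := hx
  have hy' : (1 : ℝ) ≤ y := hy
  simp only [smul_eq_mul]
  induction n with
  | zero => simp [chebRatio]
  | succ n ih =>
    have hA : 0 < 2 * x - chebRatio n x := by linarith [(chebRatio_mem_Icc n hx').2]
    have hB : 0 < 2 * y - chebRatio n y := by linarith [(chebRatio_mem_Icc n hy').2]
    have inv_convex := (convexOn_zpow (𝕜 := ℝ) (-1)).2 hA hB ha hb hab
    simp only [smul_eq_mul, _root_.zpow_neg_one] at inv_convex
    refine (inv_anti₀ ?_ ?_).trans inv_convex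
    on_goal 2 => linarith
    rcases ha.eq_or_lt with rfl | ha
    · have : b = 1 := by linarith
      subst this
      linarith
    · have := mul_pos ha hA
      have := mul_nonneg hb hB.le
      linarith

lemma polyU_eval_pos_and_ratio (n : ℕ) {x : ℝ} (hx : 1 ≤ x) :
    0 < (polyU n).eval x ∧
      chebRatio (n + 1) x * (polyU (n + 1)).eval x = (polyU n).eval x := by
  induction n with
  | zero =>
    have : x ≠ 0 := by positivity
    simp [polyU, chebRatio]
    field_simp
  | succ n ih =>
    obtain ⟨hpos, hr⟩ := ih
    obtain ⟨h0, h1⟩ := chebRatio_mem_Icc (n + 1) hx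
    have hD : 0 < 2 * x - chebRatio (n + 1) x := by linarith
    have hU : 0 < (polyU (n + 1)).eval x := by
      by_contra! h
      nlinarith
    refine ⟨hU, ?_⟩
    rw [chebRatio, inv_mul_eq_iff_eq_mul₀ hD.ne']
    simp only [polyU, Polynomial.eval_sub, Polynomial.eval_mul, Polynomial.eval_ofNat,
      Polynomial.eval_X] at hr ⊢
    linarith

lemma polyP_eq_polyU (n : ℕ) :
    polyP (n + 2) = (2 * Polynomial.X - 4) * polyU (n + 1) + polyU n := by
  induction n using Nat.twoStepInduction with
  | zero => simp only [polyP, polyU]; ring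
  | one => simp only [polyP, polyU]; ring
  | more n ih1 ih2 =>
    rw [polyP, ih1, ih2]
    simp only [polyU]
    ring

lemma polyP_eval_eq_zero_iff (n : ℕ) {x : ℝ} (hx : 1 ≤ x) :
    (polyP (n + 1)).eval x = 0 ↔ chebRatio n x = 4 - 2 * x := by
  cases n with
  | zero =>
    simp only [polyP, chebRatio, Polynomial.eval_sub, Polynomial.eval_mul,
      Polynomial.eval_ofNat, Polynomial.eval_X]
    constructor <;> intro h <;> linarith
  | succ n =>
    have hU := (polyU_eval_pos_and_ratio (n + 1) hx).1
    have hr := (polyU_eval_pos_and_ratio n hx).2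
    have key : (polyP (n + 2)).eval x =
        (chebRatio (n + 1) x - (4 - 2 * x)) * (polyU (n + 1)).eval x := by
      rw [polyP_eq_polyU]
      simp only [Polynomial.eval_sub, Polynomial.eval_mul, Polynomial.eval_add,
        Polynomial.eval_ofNat, Polynomial.eval_X, ← hr]
      ring
    rw [key, mul_eq_zero, or_iff_left hU.ne', sub_eq_zero]

lemma not_lt_of_polyP_roots (n : ℕ) {x y : ℝ} (hx : 1 < x)
    (hPx : (polyP (n + 1)).eval x = 0) (hPy : (polyP (n + 1)).eval y = 0) : ¬ x < y := by
  intro hxy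
  have hy := hx.trans hxy
  rw [polyP_eval_eq_zero_iff n hx.le] at hPx
  rw [polyP_eval_eq_zero_iff n hy.le] at hPy
  have h1 := (chebRatio_mem_Icc n le_rfl).2
  have hs := (chebRatio_convexOn n).slope_mono_adjacent (Set.mem_Ici.2 le_rfl)
    (Set.mem_Ici.2 hy.le) hx hxy
  rw [hPx, hPy, div_le_div_iff₀ (by linarith) (by linarith)] at hs
  nlinarith

lemma polyP_eval_left (n : ℕ) :
    (polyP n).eval ((6 + √2) / 4) = -(1 - √2 / 2) ^ n := by
  have h2 : √2 ^ 2 = (2 : ℝ) := Real.sq_sqrt (by norm_num)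
  induction n using Nat.twoStepInduction with
  | zero => simp [polyP]
  | one =>
    simp only [polyP, Polynomial.eval_sub, Polynomial.eval_mul, Polynomial.eval_ofNat,
      Polynomial.eval_X]
    ring
  | more n ih1 ih2 =>
    simp only [polyP, Polynomial.eval_sub, Polynomial.eval_mul, Polynomial.eval_ofNat,
      Polynomial.eval_X, ih1, ih2]
    linear_combination (1 / 2) * (1 - √2 / 2) ^ n * h2

lemma polyP_eval_two (n : ℕ) :
    0 ≤ (polyP (n + 1)).eval 2 ∧ (polyP n).eval 2 ≤ (polyP (n + 1)).eval 2 := by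
  induction n with
  | zero => norm_num [polyP]
  | succ n ih =>
    obtain ⟨h1, h2⟩ := ih
    simp only [polyP, Polynomial.eval_sub, Polynomial.eval_mul, Polynomial.eval_ofNat,
      Polynomial.eval_X]
    constructor <;> linarith

theorem stmt13 (m : ℕ) (hm : 1 ≤ m) :
    ∃ x : ℝ, 1 < x ∧ (polyP m).eval x = 0 ∧
      (6 + Real.sqrt 2) / 4 < x ∧ x ≤ 2 ∧
      ∀ y : ℝ, 1 < y → (polyP m).eval y = 0 → y = x := by
  obtain ⟨n, rfl⟩ : ∃ n, m = n + 1 := ⟨m - 1, by omega⟩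
  have h2 : √2 ^ 2 = (2 : ℝ) := Real.sq_sqrt (by norm_num)
  have h0 : 0 ≤ √2 := Real.sqrt_nonneg 2
  have hlt : √2 < 2 := by nlinarith
  have hleft : (polyP (n + 1)).eval ((6 + √2) / 4) < 0 := by
    rw [polyP_eval_left]
    have : 0 < (1 - √2 / 2) ^ (n + 1) := pow_pos (by linarith) _
    linarith
  obtain ⟨x, ⟨hax, hx2⟩, hx⟩ := intermediate_value_Ioc (by linarith : (6 + √2) / 4 ≤ 2)
    (polyP (n + 1)).continuous.continuousOn ⟨hleft, (polyP_eval_two n).1⟩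
  have h1x : 1 < x := by linarith
  refine ⟨x, h1x, hx, hax, hx2, fun y hy hPy => le_antisymm ?_ ?_⟩
  · exact not_lt.1 (not_lt_of_polyP_roots n h1x hx hPy)
  · exact not_lt.1 (not_lt_of_polyP_roots n hy hPy hx)
end
end

section
/- For each integer m ≥ 1 let x_m denote the unique root of P_m in the interval (1, ∞). Then the sequence (x_m) is strictly decreasing and converges to (6 + √2)/4. -/
open Real Matrix Filter

noncomputable section

theorem eval_polyP_add_two (n : ℕ) (y : ℝ) :
    (polyP (n + 2)).eval y = 2 * y * (polyP (n + 1)).eval y - (polyP n).eval y := by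
  simp [polyP]

theorem eval_polyP_zero (y : ℝ) : (polyP 0).eval y = -1 := by
  simp [polyP]

theorem eval_polyP_one (y : ℝ) : (polyP 1).eval y = 2 * y - 4 := by
  simp [polyP]

theorem eval_polyP_at_one (n : ℕ) : (polyP n).eval 1 = -((n : ℝ) + 1) := by
  induction n using Nat.twoStepInduction with
  | zero => simp [eval_polyP_zero]
  | one => rw [eval_polyP_one]; norm_num
  | more n h₀ h₁ => rw [eval_polyP_add_two, h₀, h₁]; push_cast; ring

theorem eval_polyP_lt_succ {y : ℝ} (hy : 1 < y) (n : ℕ) (h : 0 ≤ (polyP n).eval y) :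
    (polyP n).eval y < (polyP (n + 1)).eval y := by
  induction n with
  | zero => rw [eval_polyP_zero] at h; linarith
  | succ k ih =>
    rw [eval_polyP_add_two]
    rcases le_or_gt 0 ((polyP k).eval y) with hk | hk
    · nlinarith [ih hk]
    · nlinarith

theorem eval_polyP_limit (n : ℕ) :
    (polyP n).eval ((6 + √2) / 4) = -((2 - √2) / 2) ^ n := by
  have hs : √2 ^ 2 = (2 : ℝ) := Real.sq_sqrt (by norm_num)
  induction n using Nat.twoStepInduction with
  | zero => simp [eval_polyP_zero]
  | one => rw [eval_polyP_one]; ring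
  | more n h₀ h₁ =>
    rw [eval_polyP_add_two, h₀, h₁]
    linear_combination ((2 - √2) / 2) ^ n * hs / 2

theorem eval_polyP_two_nonneg (n : ℕ) : 0 ≤ (polyP (n + 1)).eval 2 := by
  induction n with
  | zero => rw [eval_polyP_one]; norm_num
  | succ k ih => exact ih.trans (eval_polyP_lt_succ (by norm_num) _ ih).le

theorem eval_polyP_succ_eq {a b : ℝ} (hab : a * b = 1) (n : ℕ) :
    (polyP (n + 1)).eval ((a + b) / 2) =
      b * (polyP n).eval ((a + b) / 2) + a ^ n * (a + 2 * b - 4) := by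
  induction n with
  | zero => rw [eval_polyP_one, eval_polyP_zero]; ring
  | succ k ih =>
    rw [eval_polyP_add_two]
    linear_combination a * ih + (polyP k).eval ((a + b) / 2) * hab

theorem eventually_eval_polyP_pos {y : ℝ} (hy : (6 + √2) / 4 < y) :
    ∀ᶠ n in atTop, 0 < (polyP n).eval y := by
  have hs : √2 ^ 2 = (2 : ℝ) := Real.sq_sqrt (by norm_num)
  have hs0 : 0 ≤ √2 := Real.sqrt_nonneg 2
  have hr : √(y ^ 2 - 1) ^ 2 = y ^ 2 - 1 := Real.sq_sqrt (by nlinarith)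
  have hr0 : 0 < √(y ^ 2 - 1) := Real.sqrt_pos.2 (by nlinarith)
  have hrlt : √(y ^ 2 - 1) < 3 * y - 4 :=
    (Real.sqrt_lt' (by linarith)).2 (by nlinarith [mul_pos (sub_pos.2 hy) (sub_pos.2 hy)])
  obtain ⟨a, ha⟩ : ∃ a, a = y + √(y ^ 2 - 1) := ⟨_, rfl⟩
  obtain ⟨b, hb⟩ : ∃ b, b = y - √(y ^ 2 - 1) := ⟨_, rfl⟩
  have hab : a * b = 1 := by rw [ha, hb]; linear_combination -hr
  have hyab : y = (a + b) / 2 := by rw [ha, hb]; ring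
  have hQ : 0 < a + 2 * b - 4 := by rw [ha, hb]; linarith
  have ha1 : 1 < a := by linarith
  have hb0 : 0 < b := pos_of_mul_pos_right (hab ▸ one_pos) (by linarith)
  have hb1 : b < 1 := by nlinarith
  have hstep := eval_polyP_succ_eq hab
  rw [← hyab] at hstep
  have hlow : ∀ n, -1 ≤ (polyP n).eval y := by
    intro n
    induction n with
    | zero => rw [eval_polyP_zero]
    | succ k ih =>
      rw [hstep]
      have : 0 < a ^ k * (a + 2 * b - 4) := by positivity
      nlinarith
  have hgrow : Tendsto (fun n : ℕ => a ^ n * (a + 2 * b - 4)) atTop atTop :=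
    (tendsto_pow_atTop_atTop_of_one_lt ha1).atTop_mul_const hQ
  obtain ⟨N, hN⟩ := eventually_atTop.1 (hgrow.eventually_gt_atTop 1)
  refine eventually_atTop.2 ⟨N + 1, fun n hn => ?_⟩
  obtain ⟨k, rfl⟩ : ∃ k, n = k + 1 := ⟨n - 1, by omega⟩
  rw [hstep]
  nlinarith [hN k (by omega), hlow k]

theorem exists_root_polyP {n : ℕ} {u v : ℝ} (huv : u ≤ v)
    (hu : (polyP n).eval u < 0) (hv : 0 ≤ (polyP n).eval v) :
    ∃ z, u < z ∧ z ≤ v ∧ (polyP n).eval z = 0 := by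
  obtain ⟨z, hz, h⟩ := intermediate_value_Ioc huv (polyP n).continuous.continuousOn ⟨hu, hv⟩
  exact ⟨z, hz.1, hz.2, h⟩

theorem stmt14 (x : ℕ → ℝ)
    (hroot : ∀ m, 1 ≤ m → 1 < x m ∧ (polyP m).eval (x m) = 0)
    (huniq : ∀ m, 1 ≤ m → ∀ y : ℝ, 1 < y → (polyP m).eval y = 0 → y = x m) :
    (∀ m, 1 ≤ m → x (m + 1) < x m) ∧
      Filter.Tendsto x Filter.atTop (nhds ((6 + Real.sqrt 2) / 4)) := by
  have hone : ∀ n, (polyP n).eval 1 < 0 := fun n => by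
    rw [eval_polyP_at_one]; linarith [n.cast_nonneg (α := ℝ)]
  have hle : ∀ m, 1 ≤ m → ∀ y, 1 < y → 0 ≤ (polyP m).eval y → x m ≤ y := by
    intro m hm y hy h
    obtain ⟨z, hz1, hzy, hz⟩ := exists_root_polyP hy.le (hone m) h
    exact huniq m hm z hz1 hz ▸ hzy
  have hlt : ∀ m, 1 ≤ m → ∀ y, 1 < y → 0 < (polyP m).eval y → x m < y := by
    intro m hm y hy h
    refine (hle m hm y hy h.le).lt_of_ne fun hxy => ?_
    rw [← hxy, (hroot m hm).2] at h
    exact h.false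
  have hs0 : 0 ≤ √2 := Real.sqrt_nonneg 2
  have hs2 : √2 < 2 := (Real.sqrt_lt' two_pos).2 (by norm_num)
  refine ⟨fun m hm => ?_, tendsto_order.2 ⟨fun y hy => ?_, fun y hy => ?_⟩⟩
  · obtain ⟨h1, h0⟩ := hroot m hm
    refine hlt (m + 1) (by omega) _ h1 ?_
    simpa only [h0] using eval_polyP_lt_succ h1 m h0.ge
  · filter_upwards [eventually_ge_atTop 1] with m hm
    have hneg : (polyP m).eval ((6 + √2) / 4) < 0 := by
      rw [eval_polyP_limit, neg_lt_zero]
      exact pow_pos (by linarith) m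
    have hnonneg : 0 ≤ (polyP m).eval 2 := by
      obtain ⟨k, rfl⟩ : ∃ k, m = k + 1 := ⟨m - 1, by omega⟩
      exact eval_polyP_two_nonneg k
    obtain ⟨z, hz1, -, hz⟩ := exists_root_polyP (by linarith) hneg hnonneg
    exact huniq m hm z (by linarith) hz ▸ hy.trans hz1
  · filter_upwards [eventually_ge_atTop 1, eventually_eval_polyP_pos hy] with m hm h
    exact hlt m hm y (by linarith) h
end
end
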